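/- arXiv:1612.02404 — 5 statements merged into one kernel-verified Lean document; each statement's English description precedes it below -/
import Mathlib

section
/- Let A be a unital C*-algebra with unit 1, let W ⊆ A be a dense complex subspace containing 1, and let L be a seminorm defined on W with {a ∈ W : L(a) = 0} = ℂ·1. Suppose the set {a + ℂ·1 : a ∈ W, L(a) ≤ 1} is totally bounded in the quotient normed space A/ℂ·1 (with the quotient norm ‖a + ℂ·1‖ = inf{‖a − z·1‖ : z ∈ ℂ}). Then the set {a + ℝ·1 : a ∈ W ∩ sa(A), L(a) ≤ 1} is totally bounded in the quotient normed space sa(A)/ℝ·1 (with the quotient norm ‖a + ℝ·1‖ = inf{‖a − t·1‖ : t ∈ ℝ}). -/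
/-- The canonical real-linear map `sa(A) ⧸ ℝ·1 → A ⧸ ℂ·1`. -/
noncomputable def selfAdjointQuotientMap (A : Type*) [NormedRing A] [StarRing A] [NormedAlgebra ℂ A]
    [StarModule ℂ A] :
    (selfAdjoint A ⧸ Submodule.span ℝ {(1 : selfAdjoint A)}) →ₗ[ℝ]
      A ⧸ Submodule.span ℂ {(1 : A)} :=
  (Submodule.span ℝ {(1 : selfAdjoint A)}).liftQ
    (((Submodule.span ℂ {(1 : A)}).mkQ.restrictScalars ℝ).comp (selfAdjoint.submodule ℝ A).subtype)
    (by
      rw [Submodule.span_le, Set.singleton_subset_iff]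
      exact (Submodule.Quotient.mk_eq_zero _).2 (Submodule.mem_span_singleton_self _))

theorem selfAdjointQuotientMap_mk {A : Type*} [NormedRing A] [StarRing A] [NormedAlgebra ℂ A]
    [StarModule ℂ A] (a : selfAdjoint A) :
    selfAdjointQuotientMap A (Submodule.Quotient.mk a) = Submodule.Quotient.mk (a : A) :=
  rfl

theorem norm_realPart_le {A : Type*} [NormedRing A] [StarRing A] [CStarRing A] [NormedAlgebra ℂ A]
    [StarModule ℂ A] (m : A) : ‖realPart m‖ ≤ ‖m‖ := by
  rw [← AddSubgroup.norm_coe, realPart_apply_coe, norm_smul]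
  have h := norm_add_le m (star m)
  rw [norm_star] at h
  norm_num
  linarith

theorem norm_selfAdjointQuotientMap {A : Type*} [NormedRing A] [StarRing A] [CStarRing A]
    [NormedAlgebra ℂ A] [StarModule ℂ A]
    (q : selfAdjoint A ⧸ Submodule.span ℝ {(1 : selfAdjoint A)}) :
    ‖selfAdjointQuotientMap A q‖ = ‖q‖ := by
  apply le_antisymm
  · refine le_of_forall_pos_le_add fun ε hε => ?_
    obtain ⟨m, rfl, hm⟩ := Submodule.Quotient.norm_mk_lt q hε
    exact (Submodule.Quotient.norm_mk_le _ (m : A)).trans hm.le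
  · obtain ⟨a, rfl⟩ := Submodule.Quotient.mk_surjective _ q
    rw [selfAdjointQuotientMap_mk]
    refine le_of_forall_pos_le_add fun ε hε => ?_
    obtain ⟨m, hma, hm⟩ := Submodule.Quotient.norm_mk_lt
      (Submodule.Quotient.mk (a : A) : A ⧸ Submodule.span ℂ {(1 : A)}) hε
    rw [Submodule.Quotient.eq, Submodule.mem_span_singleton] at hma
    obtain ⟨z, hz⟩ := hma
    have h : (Submodule.Quotient.mk (realPart m) :
        selfAdjoint A ⧸ Submodule.span ℝ {(1 : selfAdjoint A)}) = Submodule.Quotient.mk a := by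
      rw [Submodule.Quotient.eq, Submodule.mem_span_singleton]
      refine ⟨z.re, ?_⟩
      have hre := congrArg realPart hz
      rw [map_sub, selfAdjoint.realPart_coe, realPart_smul, realPart_one,
        (IsSelfAdjoint.one A).imaginaryPart, smul_zero, sub_zero] at hre
      exact hre
    rw [← h]
    exact ((Submodule.Quotient.norm_mk_le _ _).trans (norm_realPart_le m)).trans hm.le


/-- Let `A` be a unital C*-algebra with unit `1`, `W ⊆ A` a dense complex
subspace containing `1`, and `L` a seminorm defined on `W` with
`{a ∈ W : L a = 0} = ℂ·1`.  If the image of `{a ∈ W : L a ≤ 1}` in the quotient normed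
space `A ⧸ ℂ·1` is totally bounded, then the image of `{a ∈ W ∩ sa(A) : L a ≤ 1}` in the
quotient normed space `sa(A) ⧸ ℝ·1` is totally bounded. -/
theorem totallyBounded_selfAdjoint_quotient_of_totallyBounded_quotient
    {A : Type*} [NormedRing A] [StarRing A] [CStarRing A] [NormedAlgebra ℂ A]
    [StarModule ℂ A] [CompleteSpace A]
    (W : Submodule ℂ A) (hWdense : Dense (W : Set A)) (hW1 : (1 : A) ∈ W)
    (L : A → ℝ)
    (hLadd : ∀ a ∈ W, ∀ b ∈ W, L (a + b) ≤ L a + L b)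
    (hLsmul : ∀ (z : ℂ), ∀ a ∈ W, L (z • a) = ‖z‖ * L a)
    (hLker : ∀ a ∈ W, (L a = 0 ↔ a ∈ Submodule.span ℂ {(1 : A)}))
    (htb : TotallyBounded
      ((Submodule.Quotient.mk : A → A ⧸ Submodule.span ℂ {(1 : A)}) ''
        {a : A | a ∈ W ∧ L a ≤ 1})) :
    TotallyBounded
      ((Submodule.Quotient.mk :
          selfAdjoint A → selfAdjoint A ⧸ Submodule.span ℝ {(1 : selfAdjoint A)}) ''
        {x : selfAdjoint A | (x : A) ∈ W ∧ L (x : A) ≤ 1}) := by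
  have hiso : Isometry (selfAdjointQuotientMap A) :=
    AddMonoidHomClass.isometry_of_norm _ norm_selfAdjointQuotientMap
  rw [← totallyBounded_image_iff hiso.isUniformInducing]
  refine htb.subset ?_
  rintro _ ⟨_, ⟨x, hx, rfl⟩, rfl⟩
  exact ⟨x, hx, (selfAdjointQuotientMap_mk x).symm⟩
end

section
/- Let A be a unital C*-algebra with unit 1, let (A_n)_{n∈ℕ} be an increasing sequence of unital finite-dimensional C*-subalgebras of A with A_0 = ℂ·1 and ⋃_{n∈ℕ} A_n dense in A, and let β : ℕ → (0,∞) satisfy lim_{n→∞} β(n) = 0. Define L(a) = sup_{n∈ℕ} dist(a, A_n)/β(n) ∈ [0,∞], where dist(a, A_n) = inf{‖a − b‖ : b ∈ A_n}. Then the set {a + ℂ·1 : a ∈ ⋃_{n∈ℕ} A_n, L(a) ≤ 1} is totally bounded in the quotient normed space A/ℂ·1 (with the quotient norm ‖a + ℂ·1‖ = inf{‖a − z·1‖ : z ∈ ℂ}). -/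
open scoped ENNReal

/-- A set lying in arbitrarily small thickenings of totally bounded sets is totally bounded. -/
theorem totallyBounded_of_forall_exists_dist_lt {X : Type*} [PseudoMetricSpace X] {s : Set X}
    (h : ∀ ε > 0, ∃ K : Set X, TotallyBounded K ∧ ∀ x ∈ s, ∃ y ∈ K, dist x y < ε) :
    TotallyBounded s := by
  refine Metric.totallyBounded_iff.2 fun ε hε => ?_
  obtain ⟨K, hK, hsK⟩ := h (ε / 2) (half_pos hε)
  obtain ⟨t, ht, hKt⟩ := Metric.totallyBounded_iff.1 hK (ε / 2) (half_pos hε)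
  refine ⟨t, ht, fun x hx => ?_⟩
  obtain ⟨y, hy, hxy⟩ := hsK x hx
  obtain ⟨z, hz, hyz⟩ := Set.mem_iUnion₂.1 (hKt hy)
  refine Set.mem_iUnion₂.2 ⟨z, hz, ?_⟩
  rw [Metric.mem_ball] at hyz ⊢
  linarith [dist_triangle x y z]

/-- Let `A` be a unital C*-algebra, `(A_n)` an increasing sequence of
unital finite-dimensional C*-subalgebras with `A_0 = ℂ·1` and `⋃_n A_n` dense, and
`β : ℕ → (0, ∞)` with `β n → 0`.  Define `L a = sup_n dist(a, A_n) / β n ∈ [0, ∞]`.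
Then the image of `{a ∈ ⋃_n A_n : L a ≤ 1}` in the quotient normed space `A ⧸ ℂ·1` is
totally bounded. -/
theorem totallyBounded_quotient_ball_of_quotient_norm_lipNorm
    {A : Type*} [NormedRing A] [StarRing A] [CStarRing A] [NormedAlgebra ℂ A]
    [StarModule ℂ A] [CompleteSpace A]
    (𝒜 : ℕ → StarSubalgebra ℂ A) (hmono : Monotone 𝒜)
    (hfd : ∀ n, FiniteDimensional ℂ (𝒜 n))
    (h0 : ∀ a : A, a ∈ 𝒜 0 ↔ ∃ z : ℂ, a = z • (1 : A))
    (hdense : Dense (⋃ n, (𝒜 n : Set A)))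
    (β : ℕ → ℝ) (hβpos : ∀ n, 0 < β n)
    (hβlim : Filter.Tendsto β Filter.atTop (nhds 0))
    (L : A → ℝ≥0∞)
    (hL : ∀ a : A, L a = ⨆ n, ENNReal.ofReal (Metric.infDist a (𝒜 n : Set A) / β n)) :
    TotallyBounded
      ((Submodule.Quotient.mk : A → A ⧸ Submodule.span ℂ {(1 : A)}) ''
        {a : A | (∃ n, a ∈ 𝒜 n) ∧ L a ≤ 1}) := by
  refine totallyBounded_of_forall_exists_dist_lt fun ε hε => ?_
  obtain ⟨n, hn⟩ := (hβlim.eventually (gt_mem_nhds hε)).exists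
  have := hfd n
  have : ProperSpace (𝒜 n) := FiniteDimensional.proper ℂ (𝒜 n)
  have hq : Continuous (Submodule.Quotient.mk : A → A ⧸ Submodule.span ℂ {(1 : A)}) :=
    continuous_quot_mk
  refine ⟨_, ((isCompact_closedBall (0 : 𝒜 n) (β 0 + 1 + ε)).image
    (hq.comp continuous_subtype_val)).totallyBounded, ?_⟩
  rintro _ ⟨a, ⟨-, ha⟩, rfl⟩
  have hdist (m : ℕ) : Metric.infDist a (𝒜 m : Set A) ≤ β m := by
    rw [hL] at ha
    rw [← div_le_one (hβpos m)]
    exact ENNReal.ofReal_le_one.1 ((le_iSup _ m).trans ha)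
  obtain ⟨c, hc, hac⟩ := (Metric.infDist_lt_iff ⟨1, one_mem (𝒜 0)⟩).1
    ((hdist 0).trans_lt (lt_add_one (β 0)))
  obtain ⟨b, hb, hab⟩ := (Metric.infDist_lt_iff ⟨1, one_mem (𝒜 n)⟩).1 ((hdist n).trans_lt hn)
  have hbc : b - c ∈ 𝒜 n := sub_mem hb (hmono (Nat.zero_le n) hc)
  refine ⟨_, ⟨⟨b - c, hbc⟩, ?_, rfl⟩, ?_⟩
  · rw [mem_closedBall_zero_iff]
    change ‖b - c‖ ≤ _
    rw [← dist_eq_norm]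
    linarith [dist_triangle b a c, dist_comm a b]
  · have hcq : (Submodule.Quotient.mk (b - c) : A ⧸ Submodule.span ℂ {(1 : A)}) =
        Submodule.Quotient.mk b := by
      obtain ⟨z, rfl⟩ := (h0 c).1 hc
      rw [Submodule.Quotient.eq, sub_sub_cancel_left]
      exact neg_mem (Submodule.smul_mem _ z (Submodule.mem_span_singleton_self 1))
    change dist _ (Submodule.Quotient.mk (b - c)) < ε
    rw [hcq, dist_eq_norm, ← Submodule.Quotient.mk_sub]
    exact (Submodule.Quotient.norm_mk_le _ _).trans_lt (dist_eq_norm a b ▸ hab)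
end

section
/- Let A be a unital C*-algebra with unit 1, and let W be a dense real subspace of sa(A) containing 1. Let L : sa(A) → [0,∞] be a lower semicontinuous seminorm with L(a) < ∞ for all a ∈ W. Let B be the norm closure in sa(A) of the set {a ∈ W : L(a) ≤ 1}, and let L̄ be the Minkowski functional of B, i.e. L̄(a) = inf{r > 0 : (1/r)·a ∈ B} (with inf ∅ = ∞). Then L̄(a) = L(a) for every a ∈ W, and {a ∈ sa(A) : L̄(a) ≤ 1} = B. -/
open scoped ENNReal

section ExtendedSeminorm

variable {E : Type*} [AddCommGroup E] [Module ℝ E]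

theorem apply_inv_smul_le_one_iff {L : E → ℝ≥0∞}
    (hL : ∀ (t : ℝ) (a : E), L (t • a) = ENNReal.ofReal |t| * L a) {r : ℝ} (hr : 0 < r) (a : E) :
    L (r⁻¹ • a) ≤ 1 ↔ L a ≤ ENNReal.ofReal r := by
  have h0 : ENNReal.ofReal r ≠ 0 := by simpa using hr
  rw [hL, abs_of_pos (inv_pos.2 hr), ENNReal.ofReal_inv_of_pos hr, mul_comm, ← div_eq_mul_inv,
    ENNReal.div_le_iff h0 ENNReal.ofReal_ne_top, one_mul]

theorem smul_mem_closure_unit_ball [TopologicalSpace E] [ContinuousConstSMul ℝ E]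
    {L : E → ℝ≥0∞} (hL : ∀ (t : ℝ) (a : E), L (t • a) = ENNReal.ofReal |t| * L a)
    (W : Submodule ℝ E) {t : ℝ} (ht : |t| ≤ 1) {a : E}
    (ha : a ∈ closure {a : E | a ∈ W ∧ L a ≤ 1}) :
    t • a ∈ closure {a : E | a ∈ W ∧ L a ≤ 1} := by
  refine map_mem_closure (continuous_const_smul t) ha fun b hb => ⟨W.smul_mem t hb.1, ?_⟩
  rw [hL]
  exact mul_le_one' (ENNReal.ofReal_le_one.2 ht) hb.2

theorem setOf_minkowski_le_one_eq [TopologicalSpace E] [ContinuousSMul ℝ E] {B : Set E}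
    (hB : IsClosed B) (hstar : ∀ t : ℝ, |t| ≤ 1 → ∀ a ∈ B, t • a ∈ B) :
    {a : E | sInf (ENNReal.ofReal '' {r : ℝ | 0 < r ∧ r⁻¹ • a ∈ B}) ≤ 1} = B := by
  ext a
  rw [Set.mem_ofPred_eq]
  refine ⟨fun ha => ?_,
    fun ha => sInf_le ⟨1, ⟨one_pos, by simpa using ha⟩, ENNReal.ofReal_one⟩⟩
  have hmem : ∀ r : ℝ, 1 < r → r⁻¹ • a ∈ B := by
    intro r hr
    have hr0 : 0 < r := one_pos.trans hr
    obtain ⟨_, ⟨s, ⟨hs, hsa⟩, rfl⟩, hsr⟩ :=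
      sInf_lt_iff.1 (lt_of_le_of_lt ha (ENNReal.one_lt_ofReal.2 hr))
    have hsr : s < r := (ENNReal.ofReal_lt_ofReal_iff hr0).1 hsr
    have h := hstar (r⁻¹ * s) ?_ _ hsa
    · rwa [smul_smul, mul_assoc, mul_inv_cancel₀ hs.ne', mul_one] at h
    · rw [abs_of_pos (by positivity), inv_mul_le_one₀ hr0]
      exact hsr.le
  have hlim : Filter.Tendsto (fun r : ℝ => r⁻¹ • a) (nhdsWithin 1 (Set.Ioi 1)) (nhds a) := by
    have h : ContinuousAt (fun r : ℝ => r⁻¹ • a) 1 :=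
      (continuousAt_inv₀ one_ne_zero).smul continuousAt_const
    simpa using h.tendsto.mono_left nhdsWithin_le_nhds
  exact hB.mem_of_tendsto hlim (Filter.eventually_of_mem self_mem_nhdsWithin hmem)

theorem minkowski_closure_eq [TopologicalSpace E]
    {L : E → ℝ≥0∞} (hL : ∀ (t : ℝ) (a : E), L (t • a) = ENNReal.ofReal |t| * L a)
    (hclosed : IsClosed {a : E | L a ≤ 1}) (W : Submodule ℝ E) {a : E} (ha : a ∈ W) :
    sInf (ENNReal.ofReal '' {r : ℝ | 0 < r ∧ r⁻¹ • a ∈ closure {a : E | a ∈ W ∧ L a ≤ 1}}) =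
      L a := by
  apply le_antisymm
  · refine le_of_forall_gt fun c hc => ?_
    obtain ⟨r, hr, hrc⟩ := ENNReal.lt_iff_exists_nnreal_btwn.1 hc
    have hr0 : (0 : ℝ) < r := NNReal.coe_pos.2 (ENNReal.coe_pos.1 (zero_le.trans_lt hr))
    refine lt_of_le_of_lt (sInf_le ⟨r, ⟨hr0, subset_closure ⟨W.smul_mem _ ha, ?_⟩⟩, rfl⟩) ?_
    · rw [apply_inv_smul_le_one_iff hL hr0, ENNReal.ofReal_coe_nnreal]
      exact hr.le
    · rwa [ENNReal.ofReal_coe_nnreal]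
  · refine le_sInf ?_
    rintro _ ⟨r, ⟨hr, hra⟩, rfl⟩
    exact (apply_inv_smul_le_one_iff hL hr a).1 (closure_minimal (fun b hb => hb.2) hclosed hra)

end ExtendedSeminorm

/-- Let `A` be a unital C*-algebra and `W` a dense real subspace of
`sa(A)` containing `1`.  Let `L : sa(A) → [0, ∞]` be a lower-semicontinuous seminorm with
`L a < ∞` for `a ∈ W`.  Let `B` be the norm closure in `sa(A)` of `{a ∈ W : L a ≤ 1}`,
and let `L̄` be the Minkowski functional of `B` (with `inf ∅ = ∞`).  Then `L̄ = L` on `W`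
and `{a ∈ sa(A) : L̄ a ≤ 1} = B`. -/
theorem minkowski_functional_of_closed_ball
    {A : Type*} [NormedRing A] [StarRing A] [CStarRing A] [NormedAlgebra ℂ A]
    [StarModule ℂ A] [CompleteSpace A]
    (W : Submodule ℝ (selfAdjoint A)) (hWdense : Dense (W : Set (selfAdjoint A)))
    (hW1 : (1 : selfAdjoint A) ∈ W)
    (L : selfAdjoint A → ℝ≥0∞)
    (hLadd : ∀ a b : selfAdjoint A, L (a + b) ≤ L a + L b)
    (hLsmul : ∀ (t : ℝ) (a : selfAdjoint A), L (t • a) = ENNReal.ofReal |t| * L a)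
    (hLlsc : ∀ r : ℝ≥0∞, IsClosed {a : selfAdjoint A | L a ≤ r})
    (hLfin : ∀ a ∈ W, L a < ∞)
    (B : Set (selfAdjoint A))
    (hB : B = closure {a : selfAdjoint A | a ∈ W ∧ L a ≤ 1})
    (Lbar : selfAdjoint A → ℝ≥0∞)
    (hLbar : ∀ a : selfAdjoint A,
      Lbar a = sInf (ENNReal.ofReal '' {r : ℝ | 0 < r ∧ r⁻¹ • a ∈ B})) :
    (∀ a ∈ W, Lbar a = L a) ∧ {a : selfAdjoint A | Lbar a ≤ 1} = B := by
  subst hB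
  obtain rfl : Lbar = _ := funext hLbar
  exact ⟨fun a ha => minkowski_closure_eq hLsmul (hLlsc 1) W ha,
    setOf_minkowski_le_one_eq isClosed_closure fun t ht _ ha =>
      smul_mem_closure_unit_ball hLsmul W ht ha⟩
end

section
/- Fix C ≥ 1 and D ≥ 0. Let A be a unital C*-algebra with unit 1, let 𝒜 ⊆ A be a dense *-subalgebra containing 1, and set S = 𝒜 ∩ sa(A). Let L : sa(A) → [0,∞] be a lower semicontinuous seminorm such that L(a) < ∞ for a ∈ S, L(a) = 0 if and only if a ∈ ℝ·1, and for all a, b ∈ S: max{ L((ab + ba)/2), L((ab − ba)/(2i)) } ≤ C(‖a‖·L(b) + ‖b‖·L(a)) + D·L(a)·L(b). Let L̄ be the Minkowski functional of the norm closure in sa(A) of {a ∈ S : L(a) ≤ 1}. Then L̄ satisfies the same (C,D)-quasi-Leibniz inequality for all a, b ∈ sa(A): max{ L̄((ab + ba)/2), L̄((ab − ba)/(2i)) } ≤ C(‖a‖·L̄(b) + ‖b‖·L̄(a)) + D·L̄(a)·L̄(b) (with the convention that the inequality holds trivially when L̄(a) = ∞ or L̄(b) = ∞). -/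
open scoped ENNReal

open Filter Topology

/-- The Minkowski functional of the closure of the part of `S` where `L ≤ 1`. -/
noncomputable def closureGauge {E : Type*} [NormedAddCommGroup E] [NormedSpace ℝ E]
    (S : Set E) (L : E → ℝ≥0∞) (x : E) : ℝ≥0∞ :=
  sInf (ENNReal.ofReal '' {r : ℝ | 0 < r ∧ r⁻¹ • x ∈ closure {a : E | a ∈ S ∧ L a ≤ 1}})

section closureGauge

variable {E : Type*} [NormedAddCommGroup E] [NormedSpace ℝ E] {S : Set E} {L : E → ℝ≥0∞}

lemma smul_mem_closure_sublevel (hS : ∀ (t : ℝ), ∀ a ∈ S, t • a ∈ S)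
    (hL : ∀ (t : ℝ), ∀ a ∈ S, L (t • a) = ENNReal.ofReal |t| * L a)
    {t r : ℝ} (ht : 0 ≤ t) {x : E}
    (hx : x ∈ closure {a : E | a ∈ S ∧ L a ≤ ENNReal.ofReal r}) :
    t • x ∈ closure {a : E | a ∈ S ∧ L a ≤ ENNReal.ofReal (t * r)} := by
  refine map_mem_closure (continuous_const_smul t) hx fun a ha ↦ ⟨hS t a ha.1, ?_⟩
  rw [hL t a ha.1, abs_of_nonneg ht, ENNReal.ofReal_mul ht]
  gcongr
  exact ha.2

lemma closureGauge_le_ofReal (hS : ∀ (t : ℝ), ∀ a ∈ S, t • a ∈ S)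
    (hL : ∀ (t : ℝ), ∀ a ∈ S, L (t • a) = ENNReal.ofReal |t| * L a)
    {r : ℝ} (hr : 0 < r) {x : E}
    (hx : x ∈ closure {a : E | a ∈ S ∧ L a ≤ ENNReal.ofReal r}) :
    closureGauge S L x ≤ ENNReal.ofReal r := by
  refine sInf_le ⟨r, ⟨hr, ?_⟩, rfl⟩
  simpa [inv_mul_cancel₀ hr.ne'] using smul_mem_closure_sublevel hS hL (inv_nonneg.2 hr.le) hx

lemma mem_closure_of_closureGauge_lt (hS : ∀ (t : ℝ), ∀ a ∈ S, t • a ∈ S)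
    (hL : ∀ (t : ℝ), ∀ a ∈ S, L (t • a) = ENNReal.ofReal |t| * L a)
    {r : ℝ} {x : E} (hx : closureGauge S L x < ENNReal.ofReal r) :
    x ∈ closure {a : E | a ∈ S ∧ L a ≤ ENNReal.ofReal r} := by
  obtain ⟨_, ⟨s, ⟨hs, hsx⟩, rfl⟩, hsr⟩ := sInf_lt_iff.1 hx
  rw [← ENNReal.ofReal_one] at hsx
  have h := smul_mem_closure_sublevel hS hL hs.le hsx
  rw [smul_inv_smul₀ hs.ne', mul_one] at h
  refine closure_mono ?_ h
  exact fun a ha ↦ ⟨ha.1, ha.2.trans hsr.le⟩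

lemma closureGauge_zero (hS : ∀ (t : ℝ), ∀ a ∈ S, t • a ∈ S)
    (hL : ∀ (t : ℝ), ∀ a ∈ S, L (t • a) = ENNReal.ofReal |t| * L a) (h0 : (0 : E) ∈ S) :
    closureGauge S L 0 = 0 := by
  have hL0 : L 0 = 0 := by simpa using hL 0 0 h0
  refine le_antisymm (ENNReal.le_of_forall_pos_le_add fun ε hε _ ↦ ?_) zero_le
  rw [zero_add, ← ENNReal.ofReal_coe_nnreal]
  exact closureGauge_le_ofReal hS hL hε (subset_closure (And.intro h0 (by simp [hL0])))

/-- A quasi-Leibniz inequality on `S` for a jointly continuous product passes to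
`closureGauge S L` on the whole space. -/
lemma closureGauge_quasiLeibniz (hS : ∀ (t : ℝ), ∀ a ∈ S, t • a ∈ S)
    (hL : ∀ (t : ℝ), ∀ a ∈ S, L (t • a) = ENNReal.ofReal |t| * L a) (h0 : (0 : E) ∈ S)
    {C D : ℝ} (hC : 0 < C) (hD : 0 ≤ D) {P : E → E → E}
    (hP : Continuous fun p : E × E ↦ P p.1 p.2)
    (hP0 : ∀ a, P a 0 = 0) (h0P : ∀ a, P 0 a = 0) (hPS : ∀ a ∈ S, ∀ b ∈ S, P a b ∈ S)
    (hPL : ∀ a ∈ S, ∀ b ∈ S, L (P a b) ≤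
      ENNReal.ofReal C * (ENNReal.ofReal ‖a‖ * L b + ENNReal.ofReal ‖b‖ * L a) +
        ENNReal.ofReal D * (L a * L b)) (a b : E) :
    closureGauge S L (P a b) ≤
      ENNReal.ofReal C * (ENNReal.ofReal ‖a‖ * closureGauge S L b +
        ENNReal.ofReal ‖b‖ * closureGauge S L a) +
        ENNReal.ofReal D * (closureGauge S L a * closureGauge S L b) := by
  have hC' : ENNReal.ofReal C ≠ 0 := by simpa using hC
  rcases eq_or_ne a 0 with rfl | ha
  · simp [h0P, closureGauge_zero hS hL h0]
  rcases eq_or_ne b 0 with rfl | hb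
  · simp [hP0, closureGauge_zero hS hL h0]
  have ha' : ENNReal.ofReal ‖a‖ ≠ 0 := by simpa using ha
  have hb' : ENNReal.ofReal ‖b‖ ≠ 0 := by simpa using hb
  rcases eq_or_ne (closureGauge S L a) ⊤ with hα | hα
  · simp only [hα, ENNReal.mul_top hb', ENNReal.mul_top hC', add_top, top_add, le_top]
  rcases eq_or_ne (closureGauge S L b) ⊤ with hβ | hβ
  · simp only [hβ, ENNReal.mul_top ha', ENNReal.mul_top hC', top_add, le_top]
  obtain ⟨α, hα0, hαe⟩ : ∃ α : ℝ, 0 ≤ α ∧ closureGauge S L a = ENNReal.ofReal α :=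
    ⟨_, ENNReal.toReal_nonneg, (ENNReal.ofReal_toReal hα).symm⟩
  obtain ⟨β, hβ0, hβe⟩ : ∃ β : ℝ, 0 ≤ β ∧ closureGauge S L b = ENNReal.ofReal β :=
    ⟨_, ENNReal.toReal_nonneg, (ENNReal.ofReal_toReal hβ).symm⟩
  have hreal : ∀ {x y r s : ℝ}, 0 ≤ x → 0 ≤ y → 0 ≤ r → 0 ≤ s →
      ENNReal.ofReal C * (ENNReal.ofReal x * ENNReal.ofReal s +
        ENNReal.ofReal y * ENNReal.ofReal r) +
        ENNReal.ofReal D * (ENNReal.ofReal r * ENNReal.ofReal s) =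
      ENNReal.ofReal (C * (x * s + y * r) + D * (r * s)) := by
    intro x y r s hx hy hr hs
    rw [← ENNReal.ofReal_mul hx, ← ENNReal.ofReal_mul hy, ← ENNReal.ofReal_mul hr,
      ← ENNReal.ofReal_add (by positivity) (by positivity), ← ENNReal.ofReal_mul hC.le,
      ← ENNReal.ofReal_mul hD, ← ENNReal.ofReal_add (by positivity) (by positivity)]
  rw [hαe, hβe, hreal (norm_nonneg a) (norm_nonneg b) hα0 hβ0]
  set K := C * (‖a‖ * β + ‖b‖ * α) + D * (α * β) with hK
  have hK0 : 0 ≤ K := by positivity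
  refine ENNReal.le_of_forall_pos_le_add fun δ hδ _ ↦ ?_
  rw [← ENNReal.ofReal_coe_nnreal, ← ENNReal.ofReal_add hK0 δ.coe_nonneg]
  have hKδ : K < K + δ := lt_add_of_pos_right _ hδ
  obtain ⟨ε, hεK, hε⟩ : ∃ ε : ℝ,
      C * (‖a‖ * (β + ε) + ‖b‖ * (α + ε)) + D * ((α + ε) * (β + ε)) < K + δ ∧ 0 < ε := by
    have hc : Continuous fun ε : ℝ ↦
        C * (‖a‖ * (β + ε) + ‖b‖ * (α + ε)) + D * ((α + ε) * (β + ε)) := by fun_prop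
    have h := (hc.tendsto 0).eventually_lt_const (u := K + δ) (by simpa [hK] using hδ)
    exact ((h.filter_mono nhdsWithin_le_nhds).and
      (self_mem_nhdsWithin : Set.Ioi (0 : ℝ) ∈ 𝓝[>] 0)).exists
  have hac := mem_closure_of_closureGauge_lt hS hL (x := a) (r := α + ε)
    (by rw [hαe]; exact (ENNReal.ofReal_lt_ofReal_iff (by positivity)).2 (by linarith))
  have hbc := mem_closure_of_closureGauge_lt hS hL (x := b) (r := β + ε)
    (by rw [hβe]; exact (ENNReal.ofReal_lt_ofReal_iff (by positivity)).2 (by linarith))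
  obtain ⟨u, hu, hua⟩ := mem_closure_iff_seq_limit.1 hac
  obtain ⟨v, hv, hvb⟩ := mem_closure_iff_seq_limit.1 hbc
  refine closureGauge_le_ofReal hS hL (hK0.trans_lt hKδ) ?_
  refine mem_closure_of_tendsto ((hP.tendsto (a, b)).comp (hua.prodMk_nhds hvb)) ?_
  have hlim : Tendsto
      (fun n ↦ C * (‖u n‖ * (β + ε) + ‖v n‖ * (α + ε)) + D * ((α + ε) * (β + ε))) atTop
      (𝓝 (C * (‖a‖ * (β + ε) + ‖b‖ * (α + ε)) + D * ((α + ε) * (β + ε)))) :=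
    (((hua.norm.mul_const _).add (hvb.norm.mul_const _)).const_mul C).add_const _
  filter_upwards [hlim.eventually_lt_const hεK] with n hn
  refine ⟨hPS _ (hu n).1 _ (hv n).1, (hPL _ (hu n).1 _ (hv n).1).trans ?_⟩
  calc
    _ ≤ ENNReal.ofReal C * (ENNReal.ofReal ‖u n‖ * ENNReal.ofReal (β + ε) +
          ENNReal.ofReal ‖v n‖ * ENNReal.ofReal (α + ε)) +
        ENNReal.ofReal D * (ENNReal.ofReal (α + ε) * ENNReal.ofReal (β + ε)) := by
      gcongr
      exacts [(hv n).2, (hu n).2, (hu n).2, (hv n).2]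
    _ = ENNReal.ofReal (C * (‖u n‖ * (β + ε) + ‖v n‖ * (α + ε)) + D * ((α + ε) * (β + ε))) :=
      hreal (norm_nonneg _) (norm_nonneg _) (by positivity) (by positivity)
    _ ≤ ENNReal.ofReal (K + δ) := ENNReal.ofReal_le_ofReal hn.le

end closureGauge

/-- Fix `C ≥ 1`, `D ≥ 0`.  Let `A` be a unital C*-algebra, `𝒜 ⊆ A` a
dense *-subalgebra containing `1`, and `S = 𝒜 ∩ sa(A)`.  Let `L : sa(A) → [0,∞]` be a
lower-semicontinuous seminorm which is finite on `S`, vanishes exactly on `ℝ·1`, and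
satisfies the `(C,D)`-quasi-Leibniz inequality on `S` for the Jordan product
`a∘b = (ab+ba)/2` and the Lie product `{a,b} = (ab−ba)/(2i)`.  Let `L̄` be the Minkowski
functional of the norm closure of `{a ∈ S : L a ≤ 1}`.  Then `L̄` satisfies the same
`(C,D)`-quasi-Leibniz inequality for all self-adjoint `a, b ∈ A` (in `[0,∞]`, so the
inequality holds trivially when `L̄ a = ∞` or `L̄ b = ∞`). -/
theorem minkowski_closure_quasiLeibniz
    {A : Type*} [NormedRing A] [StarRing A] [CStarRing A] [NormedAlgebra ℂ A]
    [StarModule ℂ A] [CompleteSpace A]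
    (C D : ℝ) (hC : 1 ≤ C) (hD : 0 ≤ D)
    (𝒜 : StarSubalgebra ℂ A) (hdense : Dense (𝒜 : Set A))
    (L : A → ℝ≥0∞)
    (hLadd : ∀ a b : A, IsSelfAdjoint a → IsSelfAdjoint b → L (a + b) ≤ L a + L b)
    (hLsmul : ∀ (t : ℝ) (a : A), IsSelfAdjoint a →
      L (t • a) = ENNReal.ofReal |t| * L a)
    (hLlsc : ∀ r : ℝ≥0∞, IsClosed {a : A | IsSelfAdjoint a ∧ L a ≤ r})
    (hLfin : ∀ a ∈ 𝒜, IsSelfAdjoint a → L a < ∞)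
    (hLker : ∀ a : A, IsSelfAdjoint a → (L a = 0 ↔ ∃ t : ℝ, a = t • (1 : A)))
    (hLeib : ∀ a b : A, a ∈ 𝒜 → b ∈ 𝒜 → IsSelfAdjoint a → IsSelfAdjoint b →
      max (L ((2⁻¹ : ℝ) • (a * b + b * a))) (L ((2 * Complex.I)⁻¹ • (a * b - b * a))) ≤
        ENNReal.ofReal C * (ENNReal.ofReal ‖a‖ * L b + ENNReal.ofReal ‖b‖ * L a) +
          ENNReal.ofReal D * (L a * L b))
    (B : Set A)
    (hB : B = closure {a : A | a ∈ 𝒜 ∧ IsSelfAdjoint a ∧ L a ≤ 1})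
    (Lbar : A → ℝ≥0∞)
    (hLbar : ∀ a : A, Lbar a = sInf (ENNReal.ofReal '' {r : ℝ | 0 < r ∧ r⁻¹ • a ∈ B})) :
    ∀ a b : A, IsSelfAdjoint a → IsSelfAdjoint b →
      max (Lbar ((2⁻¹ : ℝ) • (a * b + b * a)))
          (Lbar ((2 * Complex.I)⁻¹ • (a * b - b * a))) ≤
        ENNReal.ofReal C * (ENNReal.ofReal ‖a‖ * Lbar b + ENNReal.ofReal ‖b‖ * Lbar a) +
          ENNReal.ofReal D * (Lbar a * Lbar b) := by
  intro a b _ _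
  set S : Set A := {a | a ∈ 𝒜 ∧ IsSelfAdjoint a} with hSdef
  obtain rfl : Lbar = closureGauge S L := by
    funext x
    simp only [hLbar, hB, closureGauge, hSdef, Set.mem_ofPred_eq, and_assoc]
  have hsmul : ∀ (t : ℝ), ∀ x ∈ 𝒜, t • x ∈ 𝒜 := fun t x hx ↦ by
    simpa using 𝒜.smul_mem hx (t : ℂ)
  have hS : ∀ (t : ℝ), ∀ x ∈ S, t • x ∈ S := fun t x hx ↦
    ⟨hsmul t x hx.1, (IsSelfAdjoint.all t).smul hx.2⟩
  have hL : ∀ (t : ℝ), ∀ x ∈ S, L (t • x) = ENNReal.ofReal |t| * L x :=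
    fun t x hx ↦ hLsmul t x hx.2
  have h0 : (0 : A) ∈ S := ⟨𝒜.zero_mem, .zero A⟩
  have hC0 : 0 < C := zero_lt_one.trans_le hC
  refine max_le ?_ ?_
  · refine closureGauge_quasiLeibniz hS hL h0 hC0 hD
      (P := fun x y ↦ (2⁻¹ : ℝ) • (x * y + y * x)) (by fun_prop) (by simp) (by simp)
      (fun x hx y hy ↦ hS _ _ ⟨add_mem (mul_mem hx.1 hy.1) (mul_mem hy.1 hx.1), ?_⟩)
      (fun x hx y hy ↦ (le_max_left _ _).trans (hLeib x y hx.1 hy.1 hx.2 hy.2)) a b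
    simp [IsSelfAdjoint, hx.2.star_eq, hy.2.star_eq, add_comm]
  · refine closureGauge_quasiLeibniz hS hL h0 hC0 hD
      (P := fun x y ↦ (2 * Complex.I)⁻¹ • (x * y - y * x)) (by fun_prop) (by simp) (by simp)
      (fun x hx y hy ↦
        ⟨𝒜.smul_mem (sub_mem (mul_mem hx.1 hy.1) (mul_mem hy.1 hx.1)) _, ?_⟩)
      (fun x hx y hy ↦ (le_max_right _ _).trans (hLeib x y hx.1 hy.1 hx.2 hy.2)) a b
    rw [IsSelfAdjoint, star_smul, star_sub, star_mul, star_mul, hx.2.star_eq, hy.2.star_eq,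
      ← neg_sub (x * y), smul_neg, ← neg_smul]
    simp
end

section
/- Let A be a unital C*-algebra with unit 1, and let (A_n)_{n∈ℕ} be an increasing sequence of unital finite-dimensional C*-subalgebras of A with ⋃_{n∈ℕ} A_n dense in A. Let L : sa(A) → [0,∞] be a seminorm with L(t·1) = 0 for all t ∈ ℝ, and suppose that {a ∈ sa(A) : L(a) ≤ 1} equals the norm closure of {a ∈ (⋃_n A_n) ∩ sa(A) : L(a) ≤ 1}. Let μ : A → ℂ be a state (a continuous linear functional with μ(1) = 1 and μ(a* a) ≥ 0 for all a), and suppose the set {a ∈ sa(A) : L(a) ≤ 1, μ(a) = 0} is totally bounded in norm. Then for every ε > 0 there exists N ∈ ℕ such that for all n ≥ N: for every a ∈ sa(A) with L(a) ≤ 1 and μ(a) = 0, there exists c ∈ A_n ∩ sa(A) with L(c) ≤ 1, μ(c) = 0, and ‖a − c‖ < ε. In particular, since {a ∈ A_n ∩ sa(A) : L(a) ≤ 1, μ(a) = 0} ⊆ {a ∈ sa(A) : L(a) ≤ 1, μ(a) = 0}, the Hausdorff distance between these two sets is at most ε for all n ≥ N. -/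
open scoped ENNReal ComplexOrder

/-- A positive linear functional on a unital star algebra with `μ 1 = 1` is real on self-adjoint
elements. -/
lemma im_eq_zero_of_isSelfAdjoint_of_pos {A : Type*} [Ring A] [StarRing A] [Module ℂ A]
    (μ : A →ₗ[ℂ] ℂ) (hμ1 : μ 1 = 1) (hμpos : ∀ a : A, 0 ≤ μ (star a * a)) {b : A}
    (hb : IsSelfAdjoint b) : (μ b).im = 0 := by
  have h1 := (Complex.le_def.1 (hμpos (b + 1))).2
  have h2 := (Complex.le_def.1 (hμpos b)).2
  have h : star (b + 1) * (b + 1) = star b * b + b + b + 1 := by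
    rw [star_add, star_one, hb.star_eq]; noncomm_ring
  rw [h] at h1
  simp only [map_add, hμ1, Complex.add_im, Complex.zero_im, Complex.one_im] at h1 h2
  linarith

/-- Let `A` be a unital C*-algebra and `(A_n)` an increasing sequence of
unital finite-dimensional C*-subalgebras with dense union.  Let `L : sa(A) → [0,∞]` be a
seminorm vanishing on `ℝ·1` whose closed unit ball `{a ∈ sa(A) : L a ≤ 1}` is the norm
closure of `{a ∈ (⋃_n A_n) ∩ sa(A) : L a ≤ 1}`.  Let `μ` be a state such that
`{a ∈ sa(A) : L a ≤ 1, μ a = 0}` is totally bounded.  Then for every `ε > 0` there is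
`N` such that for all `n ≥ N` every `a ∈ sa(A)` with `L a ≤ 1` and `μ a = 0` admits
`c ∈ A_n ∩ sa(A)` with `L c ≤ 1`, `μ c = 0` and `‖a − c‖ < ε`; in particular the Hausdorff
distance between `{a ∈ A_n ∩ sa(A) : L a ≤ 1, μ a = 0}` and
`{a ∈ sa(A) : L a ≤ 1, μ a = 0}` is at most `ε` for all `n ≥ N`. -/
theorem finite_dimensional_balls_approximate
    {A : Type*} [NormedRing A] [StarRing A] [CStarRing A] [NormedAlgebra ℂ A]
    [StarModule ℂ A] [CompleteSpace A]
    (𝒜 : ℕ → StarSubalgebra ℂ A) (hmono : Monotone 𝒜)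
    (hfd : ∀ n, FiniteDimensional ℂ (𝒜 n))
    (hdense : Dense (⋃ n, (𝒜 n : Set A)))
    (L : A → ℝ≥0∞)
    (hLadd : ∀ a b : A, IsSelfAdjoint a → IsSelfAdjoint b → L (a + b) ≤ L a + L b)
    (hLsmul : ∀ (t : ℝ) (a : A), IsSelfAdjoint a →
      L (t • a) = ENNReal.ofReal |t| * L a)
    (hLone : ∀ t : ℝ, L (t • (1 : A)) = 0)
    (hball : {a : A | IsSelfAdjoint a ∧ L a ≤ 1} =
      closure {a : A | (∃ n, a ∈ 𝒜 n) ∧ IsSelfAdjoint a ∧ L a ≤ 1})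
    (μ : A →L[ℂ] ℂ) (hμ1 : μ 1 = 1) (hμpos : ∀ a : A, 0 ≤ μ (star a * a))
    (htb : TotallyBounded {a : A | IsSelfAdjoint a ∧ L a ≤ 1 ∧ μ a = 0}) :
    ∀ ε > (0 : ℝ), ∃ N : ℕ, ∀ n ≥ N,
      (∀ a : A, IsSelfAdjoint a → L a ≤ 1 → μ a = 0 →
        ∃ c ∈ 𝒜 n, IsSelfAdjoint c ∧ L c ≤ 1 ∧ μ c = 0 ∧ ‖a - c‖ < ε) ∧
      Metric.hausdorffDist
        {a : A | a ∈ 𝒜 n ∧ IsSelfAdjoint a ∧ L a ≤ 1 ∧ μ a = 0}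
        {a : A | IsSelfAdjoint a ∧ L a ≤ 1 ∧ μ a = 0} ≤ ε := by
  intro ε hε
  set K : ℝ := 1 + ‖μ‖ * ‖(1 : A)‖ with hK
  have hKpos : 0 < K := by positivity
  have key : ∀ y : A, IsSelfAdjoint y → L y ≤ 1 → μ y = 0 →
      ∃ n, ∃ c ∈ 𝒜 n, IsSelfAdjoint c ∧ L c ≤ 1 ∧ μ c = 0 ∧ ‖y - c‖ < ε / 2 := by
    intro y hy hLy hμy
    have hmem : y ∈ closure {a : A | (∃ n, a ∈ 𝒜 n) ∧ IsSelfAdjoint a ∧ L a ≤ 1} :=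
      hball ▸ ⟨hy, hLy⟩
    obtain ⟨b, ⟨⟨n, hbn⟩, hb, hLb⟩, hyb⟩ :=
      Metric.mem_closure_iff.1 hmem (ε / 2 / K) (by positivity)
    rw [dist_eq_norm, lt_div_iff₀ hKpos] at hyb
    have hre : ((μ b).re : ℂ) = μ b :=
      Complex.ext rfl (im_eq_zero_of_isSelfAdjoint_of_pos (μ : A →ₗ[ℂ] ℂ) hμ1 hμpos hb).symm
    have hsmul : (-(μ b).re) • (1 : A) = -(μ b • (1 : A)) := by
      rw [neg_smul, ← Complex.coe_smul, hre]
    have hsa : IsSelfAdjoint ((-(μ b).re) • (1 : A)) :=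
      (IsSelfAdjoint.all _).smul (IsSelfAdjoint.one A)
    refine ⟨n, b + (-(μ b).re) • (1 : A), ?_, hb.add hsa, ?_, ?_, ?_⟩
    · rw [hsmul]
      exact add_mem hbn (neg_mem (SMulMemClass.smul_mem _ (one_mem _)))
    · calc L (b + (-(μ b).re) • (1 : A)) ≤ L b + L ((-(μ b).re) • (1 : A)) := hLadd _ _ hb hsa
        _ ≤ 1 := by rwa [hLone, add_zero]
    · rw [hsmul, map_add, map_neg, map_smul, hμ1, smul_eq_mul, mul_one, add_neg_cancel]
    · have hμb : ‖μ b‖ ≤ ‖μ‖ * ‖y - b‖ := by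
        simpa [hμy] using μ.le_opNorm (y - b)
      calc ‖y - (b + (-(μ b).re) • (1 : A))‖ = ‖(y - b) + μ b • (1 : A)‖ := by
            rw [hsmul]; congr 1; abel
        _ ≤ ‖y - b‖ + ‖μ b‖ * ‖(1 : A)‖ := (norm_add_le _ _).trans (by rw [norm_smul])
        _ ≤ ‖y - b‖ + ‖μ‖ * ‖y - b‖ * ‖(1 : A)‖ := by gcongr
        _ = ‖y - b‖ * K := by rw [hK]; ring
        _ < ε / 2 := hyb
  obtain ⟨t, hts, htfin, htcov⟩ := Metric.finite_approx_of_totallyBounded htb (ε / 2) (half_pos hε)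
  choose! m c hcm hc hLc hμc hyc using key
  obtain ⟨N, hN⟩ := (htfin.image m).bddAbove
  refine ⟨N, fun n hn => ?_⟩
  have happrox : ∀ a : A, IsSelfAdjoint a → L a ≤ 1 → μ a = 0 →
      ∃ c ∈ 𝒜 n, IsSelfAdjoint c ∧ L c ≤ 1 ∧ μ c = 0 ∧ ‖a - c‖ < ε := by
    intro a ha hLa hμa
    obtain ⟨y, hyt, hay⟩ := Set.mem_iUnion₂.1 (htcov ⟨ha, hLa, hμa⟩)
    obtain ⟨hy, hLy, hμy⟩ := hts hyt
    refine ⟨c y, hmono ((hN (Set.mem_image_of_mem m hyt)).trans hn) (hcm y hy hLy hμy),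
      hc y hy hLy hμy, hLc y hy hLy hμy, hμc y hy hLy hμy, ?_⟩
    rw [Metric.mem_ball, dist_eq_norm] at hay
    have := hyc y hy hLy hμy
    linarith [norm_sub_le_norm_sub_add_norm_sub a y (c y)]
  refine ⟨happrox, Metric.hausdorffDist_le_of_mem_dist hε.le ?_ ?_⟩
  · rintro x ⟨-, hx⟩
    exact ⟨x, hx, by simpa using hε.le⟩
  · rintro x ⟨hx, hLx, hμx⟩
    obtain ⟨d, hd, hsd, hLd, hμd, hxd⟩ := happrox x hx hLx hμx
    exact ⟨d, ⟨hd, hsd, hLd, hμd⟩, by rw [dist_eq_norm]; exact hxd.le⟩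
end
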